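/- Let n₀, …, n_{k−1} be positive even integers, D = ∏_{s} ℤ/n_sℤ with standard generators e_s, and let q : D → ℚ/ℤ be a pure quadratic form. If (n_s²/2)·q(e_s) = 0 in ℚ/ℤ for every index s, then 2·q(x) = 0 for every x ∈ D with x = −x; that is, the associated group category is unimodal. -/

import Mathlib

/-- The polar form `b(x,y) := q(x+y) - q(x) - q(y)` of a function `q : D → ℚ/ℤ`. -/
def polarForm {D : Type*} [AddCommGroup D] (q : D → AddCircle (1 : ℚ)) (x y : D) :
    AddCircle (1 : ℚ) :=
  q (x + y) - q x - q y

/-- A pure quadratic form on an abelian group `D` valued in `ℚ/ℤ`: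
`q(n • x) = n ^ 2 • q x` for all integers `n`, and the polar form is biadditive. -/
def IsPureQuadratic {D : Type*} [AddCommGroup D] (q : D → AddCircle (1 : ℚ)) : Prop :=
  (∀ (n : ℤ) (x : D), q (n • x) = n ^ 2 • q x) ∧
  (∀ x x' y : D, polarForm q (x + x') y = polarForm q x y + polarForm q x' y) ∧
  (∀ x y y' : D, polarForm q x (y + y') = polarForm q x y + polarForm q x y')

/-- For `D = ∏ s, ℤ/n_sℤ` with all `n s` even, if `(n_s²/2) • q (e_s) = 0` for every `s`,
then `2 • q x = 0` for every self-dual `x`, i.e. the group category built from `(D, q)`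
is unimodal. -/
theorem unimodal_sufficient_condition (k : ℕ) (n : Fin k → ℕ) (hn : ∀ s, 0 < n s)
    (he : ∀ s, Even (n s))
    (q : (∀ s, ZMod (n s)) → AddCircle (1 : ℚ)) (hq : IsPureQuadratic q)
    (h : ∀ s, ((n s) ^ 2 / 2) • q (Pi.single s 1) = 0) :
    ∀ x : ∀ s, ZMod (n s), x = -x → 2 • q x = 0 := by
  obtain ⟨hq1, hq2, -⟩ := hq
  have q0 : q 0 = 0 := by simpa using hq1 0 0
  have add2 : ∀ a b, a + a = 0 → 2 • q a = 0 → 2 • q b = 0 → 2 • q (a + b) = 0 := by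
    intro a b haa ha hb
    have h1 := hq2 a a b
    rw [haa] at h1
    have h0 : polarForm q 0 b = 0 := by simp [polarForm, q0]
    rw [h0, ← two_nsmul, polarForm, nsmul_sub, nsmul_sub, ha, hb] at h1
    simpa using h1.symm
  intro x hx
  have hxs : ∀ s, x s = - x s := fun s => congrFun hx s
  have key : ∀ s, 2 • q (Pi.single s (x s)) = 0 := by
    intro s
    have : NeZero (n s) := ⟨(hn s).ne'⟩
    rcases (ZMod.neg_eq_self_iff (x s)).1 (hxs s).symm with h0 | h0
    · rw [h0, Pi.single_zero, q0, smul_zero]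
    · have e : (Pi.single s (x s) : ∀ s, ZMod (n s))
          = (((x s).val : ℕ) : ℤ) • (Pi.single s 1 : ∀ s, ZMod (n s)) := by
        rw [← Pi.single_smul]
        congr 1
        simp
      have h2 : (n s) ^ 2 / 2 = 2 * (x s).val ^ 2 := by
        have aux : ∀ m v : ℕ, 2 * v = m → m ^ 2 / 2 = 2 * v ^ 2 := by
          rintro _ v rfl
          apply Nat.div_eq_of_eq_mul_left two_pos
          ring
        exact aux _ _ h0
      have h3 := h s
      rw [h2, mul_smul] at h3
      rw [e, hq1]
      have e2 : (((x s).val : ℕ) : ℤ) ^ 2 = (((x s).val ^ 2 : ℕ) : ℤ) := by push_cast; rfl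
      rw [e2, natCast_zsmul]
      exact h3
  have main : ∀ S : Finset (Fin k), 2 • q (∑ s ∈ S, Pi.single s (x s)) = 0 := by
    intro S
    induction S using Finset.induction_on with
    | empty => simp [q0]
    | insert a S ha ih =>
      rw [Finset.sum_insert ha]
      refine add2 _ _ ?_ (key a) ih
      rw [← Pi.single_add]
      have : x a + x a = 0 := by
        nth_rewrite 2 [hxs a]
        simp
      rw [this, Pi.single_zero]
  have := main Finset.univ
  rwa [Finset.univ_sum_single] at this
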